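/- arXiv:2311.17342 — 2 statements merged into one kernel-verified Lean document; each statement's English description precedes it below -/
import Mathlib

section
/- For every finite connected simple graph G, the inequalities dsn(G) ≤ sn(G) ≤ cart(G) hold. -/
open SimpleGraph

universe u


/-- An egg of a graph `G`: a nonempty set of vertices inducing a connected subgraph. -/
def SimpleGraph.IsEgg {V : Type u} (G : SimpleGraph V) (A : Finset V) : Prop :=
  A.Nonempty ∧ (G.induce (A : Set V)).Connected

/-- A scramble on `G`: a nonempty finite collection of eggs. -/
def SimpleGraph.IsScramble {V : Type u} (G : SimpleGraph V) (S : Finset (Finset V)) : Prop :=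
  S.Nonempty ∧ ∀ A ∈ S, G.IsEgg A

/-- The hitting number `h(S)`: the minimum cardinality of a set of vertices meeting
every egg of `S`. -/
noncomputable def hittingNumber {V : Type u} (S : Finset (Finset V)) : ℕ :=
  sInf {n | ∃ H : Finset V, H.card = n ∧ ∀ A ∈ S, ∃ x ∈ H, x ∈ A}

/-- The number of edges of `G` with one endpoint in `A` and the other outside of `A`. -/
noncomputable def cutSize {V : Type u} (G : SimpleGraph V) (A : Set V) : ℕ :=
  Set.ncard {e : Sym2 V | ∃ u v, e = s(u, v) ∧ G.Adj u v ∧ u ∈ A ∧ v ∉ A}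

/-- An egg-cut for a scramble `S`: a vertex subset `A` containing some egg of `S` and
whose complement contains some egg of `S`. -/
def IsEggCut {V : Type u} (S : Finset (Finset V)) (A : Set V) : Prop :=
  (∃ B ∈ S, (B : Set V) ⊆ A) ∧ (∃ B ∈ S, (B : Set V) ⊆ Aᶜ)

/-- The egg-cut number `e(S)` (in `ℕ∞`): the minimum size of an egg-cut for `S`,
or `⊤` if no egg-cut exists. -/
noncomputable def eggCutNumber {V : Type u} (G : SimpleGraph V) (S : Finset (Finset V)) : ℕ∞ :=
  sInf {n : ℕ∞ | ∃ A : Set V, IsEggCut S A ∧ n = (cutSize G A : ℕ∞)}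

/-- The order `‖S‖` of a scramble: the minimum of its hitting number and
its egg-cut number. -/
noncomputable def scrambleOrder {V : Type u} (G : SimpleGraph V) (S : Finset (Finset V)) : ℕ∞ :=
  min (hittingNumber S : ℕ∞) (eggCutNumber G S)

/-- The scramble number `sn(G)`: the maximum order of a scramble on `G`. -/
noncomputable def scrambleNumber {V : Type u} (G : SimpleGraph V) : ℕ :=
  sSup {n | ∃ S : Finset (Finset V), G.IsScramble S ∧ scrambleOrder G S = (n : ℕ∞)}

/-- A disjoint scramble: a scramble whose eggs are pairwise disjoint. -/
def IsDisjointScramble {V : Type u} (G : SimpleGraph V) (S : Finset (Finset V)) : Prop :=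
  G.IsScramble S ∧ (S : Set (Finset V)).Pairwise fun A B => Disjoint (A : Set V) (B : Set V)

/-- The disjoint scramble number `dsn(G)`: the maximum order of a disjoint scramble on `G`. -/
noncomputable def disjointScrambleNumber {V : Type u} (G : SimpleGraph V) : ℕ :=
  sSup {n | ∃ S : Finset (Finset V), IsDisjointScramble G S ∧ scrambleOrder G S = (n : ℕ∞)}

/-- The carton number `cart(G)`: the minimum size (number of eggs) of a scramble on `G`
whose order equals the scramble number of `G`. -/
noncomputable def cartonNumber {V : Type u} (G : SimpleGraph V) : ℕ :=
  sInf {n | ∃ S : Finset (Finset V), G.IsScramble S ∧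
    scrambleOrder G S = (scrambleNumber G : ℕ∞) ∧ S.card = n}

/-- The maximum degree of a graph. -/
noncomputable def maxDeg {V : Type u} (G : SimpleGraph V) : ℕ :=
  sSup {n | ∃ v : V, (G.neighborSet v).ncard = n}

theorem hittingNumber_le_card {V : Type u} {S : Finset (Finset V)} (hS : ∀ A ∈ S, A.Nonempty) :
    hittingNumber S ≤ S.card := by
  classical
  choose f hf using hS
  let H : Finset V := S.attach.image fun A => f A.1 A.2
  have hH : hittingNumber S ≤ H.card :=
    Nat.sInf_le ⟨H, rfl, fun A hA =>
      ⟨f A hA, Finset.mem_image.2 ⟨⟨A, hA⟩, Finset.mem_attach _ _, rfl⟩, hf A hA⟩⟩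
  exact hH.trans (Finset.card_image_le.trans_eq S.card_attach)

theorem SimpleGraph.IsScramble.scrambleOrder_le_card {V : Type u} {G : SimpleGraph V}
    {S : Finset (Finset V)} (hS : G.IsScramble S) : scrambleOrder G S ≤ (S.card : ℕ∞) :=
  (min_le_left _ _).trans (Nat.cast_le.2 (hittingNumber_le_card fun A hA => (hS.2 A hA).1))

theorem exists_scrambleOrder_eq {V : Type u} (G : SimpleGraph V) (S : Finset (Finset V)) :
    ∃ n : ℕ, scrambleOrder G S = (n : ℕ∞) := by
  have h : scrambleOrder G S ≠ ⊤ := ne_top_of_le_ne_top (ENat.natCast_ne_top _) (min_le_left _ _)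
  obtain ⟨n, hn⟩ := ENat.ne_top_iff_exists.1 h
  exact ⟨n, hn.symm⟩

theorem bddAbove_scrambleOrder {V : Type u} [Fintype V] (G : SimpleGraph V) :
    BddAbove {n : ℕ | ∃ S : Finset (Finset V), G.IsScramble S ∧ scrambleOrder G S = (n : ℕ∞)} := by
  refine ⟨Fintype.card (Finset V), ?_⟩
  rintro n ⟨S, hS, hn⟩
  exact (Nat.cast_le.1 (hn ▸ hS.scrambleOrder_le_card)).trans S.card_le_univ

theorem isDisjointScramble_singleton_univ {V : Type u} [Fintype V] {G : SimpleGraph V}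
    (hconn : G.Connected) : IsDisjointScramble G {Finset.univ} := by
  refine ⟨⟨Finset.singleton_nonempty _, fun A hA => ?_⟩, by simp⟩
  obtain rfl := Finset.mem_singleton.1 hA
  have := hconn.nonempty
  refine ⟨Finset.univ_nonempty, ?_⟩
  rw [Finset.coe_univ]
  exact (SimpleGraph.induceUnivIso G).connected_iff.2 hconn

/-- For every finite connected simple graph `G`,
`dsn(G) ≤ sn(G) ≤ cart(G)`. -/
theorem dsn_le_sn_le_carton {V : Type u} [Fintype V] (G : SimpleGraph V)
    (hconn : G.Connected) :
    disjointScrambleNumber G ≤ scrambleNumber G ∧ scrambleNumber G ≤ cartonNumber G := by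
  have huniv := isDisjointScramble_singleton_univ hconn
  obtain ⟨m, hm⟩ := exists_scrambleOrder_eq G {Finset.univ}
  constructor
  · exact csSup_le_csSup (bddAbove_scrambleOrder G) ⟨m, _, huniv, hm⟩
      fun n ⟨S, hS, hn⟩ => ⟨S, hS.1, hn⟩
  · obtain ⟨S, hS, hn⟩ : ∃ S, G.IsScramble S ∧ scrambleOrder G S = (scrambleNumber G : ℕ∞) :=
      Nat.sSup_mem (s := {n : ℕ | ∃ S, G.IsScramble S ∧ scrambleOrder G S = (n : ℕ∞)})
        ⟨m, _, huniv.1, hm⟩ (bddAbove_scrambleOrder G)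
    refine le_csInf ⟨S.card, S, hS, hn, rfl⟩ ?_
    rintro _ ⟨T, hT, hn, rfl⟩
    exact Nat.cast_le.1 (hn ▸ hT.scrambleOrder_le_card)
end

section
/- Let G be a finite connected simple graph with at least one edge and maximum degree Δ(G). Then sn(G) ≤ (tw(G) + 1)·Δ(G) − 1. -/
open SimpleGraph

universe u


/-- A tree decomposition of a graph `G`: a finite tree `T` together with a bag of
vertices for each node, covering all vertices and all edges, such that for each vertex
the set of nodes whose bag contains it induces a connected subtree. -/
structure TreeDecomp {V : Type u} (G : SimpleGraph V) where
  β : Type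
  fintypeβ : Fintype β
  T : SimpleGraph β
  isTree : T.IsTree
  bag : β → Finset V
  bag_cover : ∀ v : V, ∃ t, v ∈ bag t
  bag_edge : ∀ u v : V, G.Adj u v → ∃ t, u ∈ bag t ∧ v ∈ bag t
  bag_conn : ∀ v : V, (T.induce {t | v ∈ bag t}).Connected

/-- The width of a tree decomposition: the maximum bag size minus one. -/
noncomputable def TreeDecomp.width {V : Type u} {G : SimpleGraph V} (D : TreeDecomp G) : ℕ :=
  sSup {n | ∃ t : D.β, (D.bag t).card = n} - 1

/-- The treewidth of `G`: the minimum width of a tree decomposition of `G`. -/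
noncomputable def treewidth {V : Type u} (G : SimpleGraph V) : ℕ :=
  sInf {n | ∃ D : TreeDecomp G, D.width = n}
theorem SimpleGraph.Connected.exists_adj_mem_notMem {α : Type*} {G : SimpleGraph α} {s : Set α}
    (hs : (G.induce s).Connected) {P : Set α} {a b : α} (ha : a ∈ s) (hb : b ∈ s)
    (haP : a ∈ P) (hbP : b ∉ P) :
    ∃ x ∈ s, ∃ y ∈ s, G.Adj x y ∧ x ∈ P ∧ y ∉ P := by
  obtain ⟨p⟩ := hs.preconnected ⟨a, ha⟩ ⟨b, hb⟩
  obtain ⟨d, -, h1, h2⟩ := p.exists_boundary_dart (Subtype.val ⁻¹' P) haP hbP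
  exact ⟨d.fst, d.fst.2, d.snd, d.snd.2, d.adj, h1, h2⟩

/-- A set of nodes of a graph whose only exit is the node `t`. -/
def SimpleGraph.ExitsOnlyAt {β : Type*} (T : SimpleGraph β) (P : Set β) (t : β) : Prop :=
  ∀ ⦃a b⦄, T.Adj a b → a ∈ P → b ∉ P → a = t

/-- In a tree, a set exiting only at `t` and containing some `z ≠ t` has a proper subset
containing `z`, avoiding `t`, whose only edge to the outside leads to `t`. -/
theorem SimpleGraph.IsTree.exists_ssubset_exitsOnlyAt {β : Type*} {T : SimpleGraph β}
    (hT : T.IsTree) {P : Set β} {t z : β} (hP : T.ExitsOnlyAt P t) (htP : t ∈ P) (hz : z ∈ P)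
    (hzt : z ≠ t) :
    ∃ C ⊂ P, ∃ c ∈ C, z ∈ C ∧ T.ExitsOnlyAt C c ∧ T.ExitsOnlyAt Cᶜ t := by
  classical
  obtain ⟨p, hp⟩ := hT.connected.exists_isPath t z
  cases p with
  | nil => exact absurd rfl hzt
  | @cons _ c _ h q =>
    rw [Walk.cons_isPath_iff] at hp
    set T' := T.deleteEdges {s(t, c)} with hT'
    have hbr : ¬ T'.Reachable t c := isAcyclic_iff_forall_isBridge.1 hT.isAcyclic (e := s(t, c)) h
    have hcz : T'.Reachable c z :=
      ⟨q.toDeleteEdge s(t, c) fun he => hp.2 (q.fst_mem_support_of_mem_edges he)⟩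
    have hcross : ∀ a b, T.Adj a b → T'.Reachable c a → ¬ T'.Reachable c b → a = c ∧ b = t := by
      intro a b hab ha hb
      by_cases he : s(a, b) = s(t, c)
      · rcases Sym2.eq_iff.1 he with ⟨rfl, rfl⟩ | ⟨rfl, rfl⟩
        · exact absurd ha.symm hbr
        · exact ⟨rfl, rfl⟩
      · exact absurd (ha.trans (Adj.reachable (by simp [hT', hab, he]))) hb
    refine ⟨{w | T'.Reachable c w}, ⟨fun w hw => ?_, fun hsub => hbr (hsub htP).symm⟩, c,
      Reachable.refl c, hcz, fun a b hab ha hb => (hcross a b hab ha hb).1,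
      fun a b hab ha hb => (hcross b a hab.symm (not_not.1 hb) ha).2⟩
    by_contra hwP
    obtain ⟨r⟩ := hcz.symm.trans hw
    obtain ⟨d, hd, h1, h2⟩ := r.exists_boundary_dart P hz hwP
    have hdt : d.fst = t := hP ((deleteEdges_le _) d.adj) h1 h2
    have hts : t ∈ r.support := hdt ▸ r.dart_fst_mem_support_of_mem_darts hd
    exact hbr (hcz.trans ⟨r.takeUntil t hts⟩).symm

namespace TreeDecomp

variable {V : Type u} {G : SimpleGraph V} (D : TreeDecomp G)

theorem mem_bag_of_exitsOnlyAt {P : Set D.β} {t : D.β} (hP : D.T.ExitsOnlyAt P t) {v : V}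
    {a b : D.β} (ha : v ∈ D.bag a) (hb : v ∈ D.bag b) (haP : a ∈ P) (hbP : b ∉ P) :
    v ∈ D.bag t := by
  obtain ⟨x, hx, y, -, hxy, hxP, hyP⟩ :=
    (D.bag_conn v).exists_adj_mem_notMem ha hb haP hbP
  exact hP hxy hxP hyP ▸ hx

/-- The vertices all of whose bags are indexed by nodes of `P`. -/
def confined (P : Set D.β) : Set V := {v | ∀ s, v ∈ D.bag s → s ∈ P}

theorem mem_bag_of_adj_of_mem_confined {P : Set D.β} {t : D.β} (hP : D.T.ExitsOnlyAt P t)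
    {u v : V} (huv : G.Adj u v) (hu : u ∈ D.confined P) (hv : v ∉ D.confined P) :
    v ∈ D.bag t := by
  obtain ⟨a, hua, hva⟩ := D.bag_edge u v huv
  simp only [confined, Set.mem_ofPred_eq, not_forall] at hv
  obtain ⟨b, hb, hbP⟩ := hv
  exact D.mem_bag_of_exitsOnlyAt hP hva hb (hu a hua) hbP

theorem mem_bag_of_adj_of_mem_confined_compl {P : Set D.β} {t : D.β}
    (hP : D.T.ExitsOnlyAt P t) {u v : V} (huv : G.Adj u v) (hu : u ∈ D.confined Pᶜ)
    (hv : v ∉ D.confined Pᶜ) : v ∈ D.bag t := by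
  obtain ⟨a, hua, hva⟩ := D.bag_edge u v huv
  simp only [confined, Set.mem_ofPred_eq, not_forall, Set.mem_compl_iff, not_not] at hv
  obtain ⟨b, hb, hbP⟩ := hv
  exact D.mem_bag_of_exitsOnlyAt hP hb hva hbP (hu a hua)

theorem subset_confined_of_connected {P : Set D.β} {t : D.β}
    (hP : ∀ u v, G.Adj u v → u ∈ D.confined P → v ∉ D.confined P → v ∈ D.bag t)
    {B : Finset V} (hB : (G.induce (B : Set V)).Connected) (hBt : ∀ v ∈ B, v ∉ D.bag t)
    {v : V} (hv : v ∈ B) (hvP : v ∈ D.confined P) : (B : Set V) ⊆ D.confined P := by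
  intro w hw
  by_contra hwP
  obtain ⟨x, -, y, hy, hxy, hxP, hyP⟩ := hB.exists_adj_mem_notMem hv hw hvP hwP
  exact hBt y hy (hP x y hxy hxP hyP)

/-- An egg missing the bag at `t` lies on one side of any set exiting only at `t`. -/
theorem subset_confined_or_compl {P : Set D.β} {t : D.β} (hP : D.T.ExitsOnlyAt P t)
    {B : Finset V} (hB : G.IsEgg B) (hBt : ∀ v ∈ B, v ∉ D.bag t) :
    (B : Set V) ⊆ D.confined P ∨ (B : Set V) ⊆ D.confined Pᶜ := by
  obtain ⟨⟨v, hv⟩, hB⟩ := hB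
  by_cases hvP : v ∈ D.confined P
  · exact .inl (D.subset_confined_of_connected
      (fun _ _ => D.mem_bag_of_adj_of_mem_confined hP) hB hBt hv hvP)
  · refine .inr (D.subset_confined_of_connected
      (fun _ _ => D.mem_bag_of_adj_of_mem_confined_compl hP) hB hBt hv fun s hs hsP => ?_)
    simp only [confined, Set.mem_ofPred_eq, not_forall] at hvP
    obtain ⟨b, hb, hbP⟩ := hvP
    exact hBt v hv (D.mem_bag_of_exitsOnlyAt hP hs hb hsP hbP)

/-- Either some bag hits all eggs, or two eggs are separated by a set of nodes
exiting only at one node. -/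
theorem exists_bag_hits_or_separates {S : Finset (Finset V)} (hS : G.IsScramble S) :
    (∃ t, ∀ B ∈ S, ∃ v ∈ D.bag t, v ∈ B) ∨
      ∃ P t, D.T.ExitsOnlyAt P t ∧ (∃ B ∈ S, (B : Set V) ⊆ D.confined P) ∧
        ∃ B ∈ S, (B : Set V) ⊆ D.confined Pᶜ := by
  have := D.fintypeβ
  suffices H : ∀ P : Set D.β, ∀ t ∈ P, D.T.ExitsOnlyAt P t →
      (∃ B ∈ S, (B : Set V) ⊆ D.confined P) → _ by
    obtain ⟨B, hB⟩ := hS.1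
    obtain ⟨t⟩ := D.isTree.connected.nonempty
    exact H Set.univ t trivial (fun _ _ _ _ h => absurd trivial h)
      ⟨B, hB, fun _ _ _ _ => trivial⟩
  intro P
  induction P using WellFoundedLT.induction with
  | ind P ih =>
    intro t htP hP hBP
    by_cases hit : ∀ B ∈ S, ∃ v ∈ D.bag t, v ∈ B
    · exact .inl ⟨t, hit⟩
    push Not at hit
    obtain ⟨B, hBS, hBt⟩ := hit
    have hB := hS.2 B hBS
    have hBt' : ∀ v ∈ B, v ∉ D.bag t := fun v hv hvt => hBt v hvt hv
    rcases D.subset_confined_or_compl hP hB hBt' with hin | hout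
    · obtain ⟨v, hv⟩ := hB.1
      obtain ⟨z, hz⟩ := D.bag_cover v
      have hzt : z ≠ t := by rintro rfl; exact hBt' v hv hz
      obtain ⟨C, hCP, c, hc, hzC, hCc, hCt⟩ :=
        D.isTree.exists_ssubset_exitsOnlyAt hP htP (hin hv z hz) hzt
      refine ih C hCP c hc hCc ⟨B, hBS, ?_⟩
      rcases D.subset_confined_or_compl hCt hB hBt' with h | h
      · exact absurd hzC (h hv z hz)
      · rwa [compl_compl] at h
    · exact .inr ⟨P, t, hP, hBP, B, hBS, hout⟩

theorem card_bag_le_width [Finite V] (t : D.β) : (D.bag t).card ≤ D.width + 1 := by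
  have := D.fintypeβ
  have : (D.bag t).card ≤ sSup {n | ∃ t : D.β, (D.bag t).card = n} :=
    le_csSup (Set.finite_range fun t => (D.bag t).card).bddAbove ⟨t, rfl⟩
  unfold width
  omega

end TreeDecomp

theorem exists_treeDecomp_width_eq_treewidth {V : Type u} [Fintype V] (G : SimpleGraph V) :
    ∃ D : TreeDecomp G, D.width = treewidth G :=
  Nat.sInf_mem (s := {n | ∃ D : TreeDecomp G, D.width = n})
    ⟨_, { β := Unit
          fintypeβ := inferInstance
          T := ⊥
          isTree := .of_subsingleton
          bag := fun _ => Finset.univ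
          bag_cover := fun v => ⟨(), Finset.mem_univ v⟩
          bag_edge := fun u v _ => ⟨(), Finset.mem_univ u, Finset.mem_univ v⟩
          bag_conn := fun v => by
            have : Nonempty {_t : Unit | v ∈ Finset.univ} := ⟨(), Finset.mem_univ v⟩
            exact IsTree.of_subsingleton.connected }, rfl⟩

theorem ncard_neighborSet_le_maxDeg {V : Type u} [Finite V] (G : SimpleGraph V) (v : V) :
    (G.neighborSet v).ncard ≤ maxDeg G :=
  le_csSup (Set.finite_range fun v => (G.neighborSet v).ncard).bddAbove ⟨v, rfl⟩

theorem ncard_edges_meeting_le {V : Type u} [Finite V] (G : SimpleGraph V) (X : Finset V) :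
    {e : Sym2 V | ∃ u v, e = s(u, v) ∧ G.Adj u v ∧ v ∈ X}.ncard ≤ X.card * maxDeg G := by
  have hsub : {e : Sym2 V | ∃ u v, e = s(u, v) ∧ G.Adj u v ∧ v ∈ X} ⊆
      ⋃ v ∈ X, (fun u => s(u, v)) '' G.neighborSet v := by
    rintro _ ⟨u, v, rfl, huv, hv⟩
    exact Set.mem_biUnion hv ⟨u, huv.symm, rfl⟩
  calc _ ≤ (⋃ v ∈ X, (fun u => s(u, v)) '' G.neighborSet v).ncard :=
        Set.ncard_le_ncard hsub (Set.toFinite _)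
    _ ≤ ∑ v ∈ X, ((fun u => s(u, v)) '' G.neighborSet v).ncard :=
        Finset.set_ncard_biUnion_le X _
    _ ≤ ∑ _v ∈ X, maxDeg G := Finset.sum_le_sum fun v _ =>
        (Set.ncard_image_le (Set.toFinite _)).trans (ncard_neighborSet_le_maxDeg G v)
    _ = X.card * maxDeg G := by simp

/-- The edges leaving the far side of a set of nodes exiting only at `t` are fewer than
the edges that the bag at `t` can meet. -/
theorem TreeDecomp.cutSize_confined_compl_lt {V : Type u} [Finite V] {G : SimpleGraph V}
    (hconn : G.Connected) (D : TreeDecomp G) {P : Set D.β} {t : D.β}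
    (hP : D.T.ExitsOnlyAt P t) (h₁ : (D.confined P).Nonempty) (h₂ : (D.confined Pᶜ).Nonempty) :
    cutSize G (D.confined Pᶜ) < (D.bag t).card * maxDeg G := by
  have hdisj : ∀ u, u ∈ D.confined P → u ∉ D.confined Pᶜ := fun u hu hu' => by
    obtain ⟨s, hs⟩ := D.bag_cover u
    exact hu' s hs (hu s hs)
  obtain ⟨a, ha⟩ := h₁
  obtain ⟨b, hb⟩ := h₂
  obtain ⟨p⟩ := hconn.preconnected a b
  obtain ⟨d, -, hd1, hd2⟩ :=
    p.exists_boundary_dart (D.confined P) ha fun h => hdisj b h hb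
  have hdt := D.mem_bag_of_adj_of_mem_confined hP d.adj hd1 hd2
  have hd2' : d.snd ∉ D.confined Pᶜ := fun h => by
    obtain ⟨s, hs, hs'⟩ := D.bag_edge _ _ d.adj
    exact h s hs' (hd1 s hs)
  refine (Set.ncard_lt_ncard ?_ (Set.toFinite _)).trans_le (ncard_edges_meeting_le G (D.bag t))
  refine ⟨?_, fun hsub => ?_⟩
  · rintro _ ⟨u, v, rfl, huv, hu, hv⟩
    exact ⟨u, v, rfl, huv, D.mem_bag_of_adj_of_mem_confined_compl hP huv hu hv⟩
  · obtain ⟨u, v, he, -, hu, -⟩ := hsub ⟨d.fst, d.snd, rfl, d.adj, hdt⟩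
    rcases Sym2.eq_iff.1 he with ⟨rfl, rfl⟩ | ⟨rfl, rfl⟩
    · exact hdisj _ hd1 hu
    · exact hd2' hu

/-- A connected graph of maximum degree at most one has only the two endpoints of any edge
as vertices. -/
theorem SimpleGraph.Connected.eq_or_eq_of_maxDeg_le_one {V : Type u} [Finite V]
    {G : SimpleGraph V} (hconn : G.Connected) (hdeg : maxDeg G ≤ 1) {u v : V} (huv : G.Adj u v)
    (w : V) : w = u ∨ w = v := by
  by_contra hw
  obtain ⟨p⟩ := hconn.preconnected u w
  obtain ⟨d, -, h1, h2⟩ := p.exists_boundary_dart {u, v} (by simp) hw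
  have hone := (Set.ncard_le_one (Set.toFinite _)).1
    ((ncard_neighborSet_le_maxDeg G d.fst).trans hdeg)
  rcases h1 with h1 | h1
  · exact h2 (.inr (hone _ d.adj _ (by rw [h1]; exact huv)))
  · exact h2 (.inl (hone _ d.adj _ (by rw [h1]; exact huv.symm)))

theorem hittingNumber_le {V : Type u} {S : Finset (Finset V)} {H : Finset V}
    (hH : ∀ A ∈ S, ∃ x ∈ H, x ∈ A) : hittingNumber S ≤ H.card :=
  Nat.sInf_le ⟨H, rfl, hH⟩

/-- In a connected graph of maximum degree at most one, a scramble with hitting number at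
least two has an egg-cut of size at most one. -/
theorem exists_isEggCut_of_maxDeg_le_one {V : Type u} [Finite V] {G : SimpleGraph V}
    (hconn : G.Connected) (hdeg : maxDeg G ≤ 1) {u v : V} (huv : G.Adj u v)
    {S : Finset (Finset V)} (hS : 2 ≤ hittingNumber S) :
    ∃ A, IsEggCut S A ∧ cutSize G A ≤ 1 := by
  have hV := hconn.eq_or_eq_of_maxDeg_le_one hdeg huv
  have hmiss : ∀ x : V, ∃ B ∈ S, x ∉ B := fun x => by
    by_contra! h
    have := hittingNumber_le (H := {x}) fun B hB => ⟨x, by simp, h B hB⟩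
    simp at this
    omega
  obtain ⟨B, hB, hvB⟩ := hmiss v
  obtain ⟨B', hB', huB'⟩ := hmiss u
  refine ⟨{u}, ⟨⟨B, hB, fun x hx => ?_⟩, B', hB', fun x hx hxu => ?_⟩, ?_⟩
  · exact (hV x).resolve_right fun h => hvB (h ▸ hx)
  · exact huB' (hxu ▸ hx)
  · refine (Set.ncard_le_ncard (t := {s(u, v)}) ?_ (Set.toFinite _)).trans_eq
      (Set.ncard_singleton _)
    rintro _ ⟨x, y, rfl, -, hx, hy⟩
    rw [Set.mem_singleton_iff] at hx ⊢
    rw [hx, (hV y).resolve_left hy]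

/-- For every finite connected simple graph `G` with at least one
edge, `sn(G) ≤ (tw(G) + 1)·Δ(G) − 1`. -/
theorem sn_le_tw_mul_maxDeg {V : Type u} [Fintype V] (G : SimpleGraph V)
    (hconn : G.Connected) (hedge : G.edgeSet.Nonempty) :
    scrambleNumber G ≤ (treewidth G + 1) * maxDeg G - 1 := by
  obtain ⟨D, hD⟩ := exists_treeDecomp_width_eq_treewidth G
  obtain ⟨⟨u, v⟩, huv⟩ := hedge
  have hbag (t : D.β) : (D.bag t).card ≤ treewidth G + 1 := hD ▸ D.card_bag_le_width t
  have hdeg : 1 ≤ maxDeg G :=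
    ((Set.ncard_pos (Set.toFinite _)).2 ⟨v, huv⟩).trans_le (ncard_neighborSet_le_maxDeg G u)
  refine csSup_le' ?_
  rintro n ⟨S, hS, hn⟩
  have hnh : n ≤ hittingNumber S := by
    have h : (n : ℕ∞) ≤ hittingNumber S := hn ▸ min_le_left _ _
    exact_mod_cast h
  have hnc : ∀ A, IsEggCut S A → n ≤ cutSize G A := fun A hA => by
    have h : (n : ℕ∞) ≤ cutSize G A := hn ▸ (min_le_right _ _).trans (sInf_le ⟨A, hA, rfl⟩)
    exact_mod_cast h
  rcases D.exists_bag_hits_or_separates hS with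
    ⟨t, ht⟩ | ⟨P, t, hP, ⟨B, hB, hBP⟩, B', hB', hBP'⟩
  · have hnw : n ≤ treewidth G + 1 := (hnh.trans (hittingNumber_le ht)).trans (hbag t)
    rcases hdeg.eq_or_lt with h1 | h2
    · obtain ⟨s, hus, hvs⟩ := D.bag_edge u v huv
      have htw : 2 ≤ treewidth G + 1 :=
        (Finset.one_lt_card.2 ⟨u, hus, v, hvs, G.ne_of_adj huv⟩).trans_le (hbag s)
      rw [← h1, mul_one]
      by_contra! hlt
      obtain ⟨A, hA, hA1⟩ :=
        exists_isEggCut_of_maxDeg_le_one hconn h1.ge huv (S := S) (by omega)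
      have := hnc A hA
      omega
    · have : (treewidth G + 1) * 2 ≤ (treewidth G + 1) * maxDeg G := Nat.mul_le_mul_left _ h2
      omega
  · have hne {C : Finset V} {Q : Set D.β} (hC : C ∈ S) (hCQ : (C : Set V) ⊆ D.confined Q) :
        (D.confined Q).Nonempty := (hS.2 C hC).1.imp fun _ h => hCQ h
    have hlt := D.cutSize_confined_compl_lt hconn hP (hne hB hBP) (hne hB' hBP')
    have hcut := hnc (D.confined Pᶜ) ⟨⟨B', hB', hBP'⟩, B, hB, fun x hx hx' => by
      obtain ⟨s, hs⟩ := D.bag_cover x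
      exact hx' s hs (hBP hx s hs)⟩
    have := Nat.mul_le_mul_right (maxDeg G) (hbag t)
    omega
end
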